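/- arXiv:1706.06708 — 2 statements merged into one kernel-verified Lean document; each statement's English description precedes it below -/
import Mathlib

section
/- Let b := b₁ · b₂ ⋯ bₙ. For every (c, r) ∈ I × I, the top sticker at position (c, r) in the configuration b(C₀) is blue — i.e., writing b⁻¹(c, r, (0, 0)) = (c′, r′, (ε₁, ε₂)), one has ε₁ + ε₂ = 1 — if and only if 1 ≤ r ≤ n and either |c| > m or l_r(|c|) = 0. -/
namespace RSq

def I (h : ℕ) : Type := {i : ℤ // i ≠ 0 ∧ |i| ≤ (h : ℤ)}

instance (h : ℕ) : DecidableEq (I h) :=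
  inferInstanceAs (DecidableEq {i : ℤ // i ≠ 0 ∧ |i| ≤ (h : ℤ)})

instance (h : ℕ) : Neg (I h) :=
  ⟨fun i => ⟨-i.1, neg_ne_zero.mpr i.2.1, by rw [abs_neg]; exact i.2.2⟩⟩

@[simp] theorem I.neg_neg {h : ℕ} (i : I h) : -(-i) = i :=
  Subtype.ext (by show -(-i.1) = i.1; exact _root_.neg_neg i.1)

abbrev S (h : ℕ) : Type := I h × I h × (ZMod 2 × ZMod 2)

@[simp] theorem zmod2_add_one_one (ε : ZMod 2) : ε + 1 + 1 = ε := by revert ε; decide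

/-- Column move: flips column `j`. -/
def X {h : ℕ} (j : I h) : Equiv.Perm (S h) :=
  Function.Involutive.toPerm
    (fun s => if s.1 = j then (s.1, -s.2.1, (s.2.2.1 + 1, s.2.2.2)) else s)
    (by
      rintro ⟨c, r, ε₁, ε₂⟩
      by_cases hc : c = j <;> simp [hc])

/-- Row move: flips row `i`. -/
def Y {h : ℕ} (i : I h) : Equiv.Perm (S h) :=
  Function.Involutive.toPerm
    (fun s => if s.2.1 = i then (-s.1, s.2.1, (s.2.2.1, s.2.2.2 + 1)) else s)
    (by
      rintro ⟨c, r, ε₁, ε₂⟩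
      by_cases hr : r = i <;> simp [hr])

/-- The side-length parameter: `h = max m n + 2n`. -/
abbrev hS (n m : ℕ) : ℕ := max m n + 2 * n

def bit {m : ℕ} (w : Fin m → Bool) (c : ℤ) : Bool :=
  if hc : 1 ≤ c ∧ c ≤ (m : ℤ) then w ⟨(c - 1).toNat, by omega⟩ else false

def colIdx {n m : ℕ} (j : Fin m) : I (hS n m) :=
  ⟨((j : ℕ) : ℤ) + 1, by
    have hj : (j : ℕ) < m := j.isLt
    have hm : m ≤ hS n m := le_trans (le_max_left m n) (Nat.le_add_right _ _)
    constructor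
    · omega
    · rw [abs_of_nonneg (by omega)]; omega⟩

def rowIdx {n m : ℕ} (i : Fin n) : I (hS n m) :=
  ⟨((i : ℕ) : ℤ) + 1, by
    have hi : (i : ℕ) < n := i.isLt
    have hn : n ≤ hS n m := le_trans (le_max_right m n) (Nat.le_add_right _ _)
    constructor
    · omega
    · rw [abs_of_nonneg (by omega)]; omega⟩

/-- `aᵢ := (X 1)^{lᵢ(1)} ⋯ (X m)^{lᵢ(m)}`. -/
def a {n m : ℕ} (l : Fin n → Fin m → Bool) (i : Fin n) : Equiv.Perm (S (hS n m)) :=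
  ((List.finRange m).map (fun j => X (colIdx (n := n) j) ^ (if l i j then 1 else 0))).prod

/-- `bᵢ := aᵢ⁻¹ · (Y i) · aᵢ`. -/
def b {n m : ℕ} (l : Fin n → Fin m → Bool) (i : Fin n) : Equiv.Perm (S (hS n m)) :=
  (a l i)⁻¹ * Y (rowIdx (m := m) i) * a l i

/-- `t := a₁ · b₁ · b₂ ⋯ bₙ`. -/
def t {n m : ℕ} (hn : 0 < n) (l : Fin n → Fin m → Bool) : Equiv.Perm (S (hS n m)) :=
  a l ⟨0, hn⟩ * ((List.finRange n).map (b l)).prod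


/-- `b := b₁ · b₂ ⋯ bₙ`. -/
def bprod {n m : ℕ} (l : Fin n → Fin m → Bool) : Equiv.Perm (S (hS n m)) :=
  ((List.finRange n).map (b l)).prod

@[simp] theorem I.neg_val {h : ℕ} (i : I h) : (-i).1 = -i.1 := rfl

theorem X_apply {h : ℕ} (j : I h) (s : S h) :
    X j s = if s.1 = j then (s.1, -s.2.1, (s.2.2.1 + 1, s.2.2.2)) else s := rfl

theorem Y_apply {h : ℕ} (i : I h) (s : S h) :
    Y i s = if s.2.1 = i then (-s.1, s.2.1, (s.2.2.1, s.2.2.2 + 1)) else s := rfl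

theorem prod_X_apply {n m : ℕ} (w : Fin m → Bool) (L : List (Fin m)) (hL : L.Nodup)
    (s : S (hS n m)) :
    (L.map (fun j => X (colIdx (n := n) j) ^ (if w j then 1 else 0))).prod s =
      if ∃ j ∈ L, w j = true ∧ s.1 = colIdx j then
        (s.1, -s.2.1, (s.2.2.1 + 1, s.2.2.2)) else s := by
  have colIdx_injective : ∀ j k : Fin m, colIdx (n := n) j = colIdx k → j = k := by
    intro j k hjk
    have := congrArg Subtype.val hjk
    simp only [colIdx] at this
    omega
  induction L with
  | nil => simp
  | cons k L ih =>
    obtain ⟨hk, hL⟩ := List.nodup_cons.mp hL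
    rw [List.map_cons, List.prod_cons, Equiv.Perm.mul_apply, ih hL]
    by_cases hw : w k = true
    · by_cases hs : s.1 = colIdx k
      · have hn : ¬ ∃ j ∈ L, w j = true ∧ s.1 = colIdx j := by
          rintro ⟨j, hj, -, hsj⟩
          exact hk (colIdx_injective _ _ (hs.symm.trans hsj) ▸ hj)
        have hp : ∃ j ∈ k :: L, w j = true ∧ s.1 = colIdx j := ⟨k, List.mem_cons_self, hw, hs⟩
        rw [if_neg hn, if_pos hp]
        simp [hw, X_apply, hs]
      · simp only [List.mem_cons, exists_eq_or_imp, hs, and_false, false_or]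
        split_ifs <;> simp [X_apply, hs]
    · simp [hw]

theorem bit_eq_true_iff {n m : ℕ} (w : Fin m → Bool) (c : I (hS n m)) :
    bit w c.1 = true ↔ ∃ j, w j = true ∧ c = colIdx j := by
  unfold bit
  constructor
  · intro h
    split_ifs at h with hc
    refine ⟨_, h, Subtype.ext ?_⟩
    simp only [colIdx]
    omega
  · rintro ⟨j, hj, rfl⟩
    have hc : 1 ≤ (colIdx (n := n) j).1 ∧ (colIdx (n := n) j).1 ≤ (m : ℤ) := by
      simp only [colIdx]
      omega
    rw [dif_pos hc]
    convert hj
    simp [colIdx]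

theorem a_apply {n m : ℕ} (l : Fin n → Fin m → Bool) (i : Fin n) (s : S (hS n m)) :
    a l i s = if bit (l i) s.1.1 = true then
      (s.1, -s.2.1, (s.2.2.1 + 1, s.2.2.2)) else s := by
  rw [a, prod_X_apply _ _ (List.nodup_finRange m)]
  simp only [List.mem_finRange, true_and, bit_eq_true_iff]

theorem a_inv {n m : ℕ} (l : Fin n → Fin m → Bool) (i : Fin n) : (a l i)⁻¹ = a l i := by
  rw [inv_eq_iff_mul_eq_one]
  ext1 s
  rw [Equiv.Perm.mul_apply, a_apply l i s]
  split_ifs with h <;> simp [a_apply, h]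

theorem b_inv {n m : ℕ} (l : Fin n → Fin m → Bool) (i : Fin n) : (b l i)⁻¹ = b l i := by
  have hY : (Y (rowIdx (m := m) i))⁻¹ = Y (rowIdx i) := rfl
  rw [b, mul_inv_rev, mul_inv_rev, inv_inv, hY, mul_assoc]

theorem b_apply {n m : ℕ} (l : Fin n → Fin m → Bool) (i : Fin n) (s : S (hS n m)) :
    b l i s = a l i (Y (rowIdx i) (a l i s)) := by
  rw [b, a_inv]
  rfl

theorem abs_row_a {n m : ℕ} (l : Fin n → Fin m → Bool) (i : Fin n) (s : S (hS n m)) :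
    |(a l i s).2.1.1| = |s.2.1.1| := by
  rw [a_apply]
  split_ifs <;> simp

theorem abs_row_b {n m : ℕ} (l : Fin n → Fin m → Bool) (i : Fin n) (s : S (hS n m)) :
    |(b l i s).2.1.1| = |s.2.1.1| := by
  rw [b_apply, abs_row_a, Y_apply]
  split_ifs <;> simp [abs_row_a]

theorem b_apply_of_abs_row_ne {n m : ℕ} (l : Fin n → Fin m → Bool) (i : Fin n)
    (s : S (hS n m)) (h : |s.2.1.1| ≠ ((i : ℕ) : ℤ) + 1) : b l i s = s := by
  have hr : (a l i s).2.1 ≠ rowIdx i := by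
    intro hr
    apply h
    rw [← abs_row_a l i s, hr]
    exact abs_of_nonneg (by simp only [rowIdx]; omega)
  rw [b_apply, Y_apply, if_neg hr]
  nth_rewrite 1 [← a_inv]
  exact Equiv.symm_apply_apply _ _

theorem prod_b_inv_apply_of_abs_row_ne {n m : ℕ} (l : Fin n → Fin m → Bool)
    (L : List (Fin n)) (s : S (hS n m)) (h : ∀ i ∈ L, |s.2.1.1| ≠ ((i : ℕ) : ℤ) + 1) :
    (L.map (b l)).prod⁻¹ s = s := by
  induction L with
  | nil => rfl
  | cons k L ih =>
    rw [List.map_cons, List.prod_cons, mul_inv_rev, Equiv.Perm.mul_apply, b_inv,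
      b_apply_of_abs_row_ne l k s (h k List.mem_cons_self)]
    exact ih fun i hi => h i (List.mem_cons_of_mem _ hi)

theorem prod_b_inv_apply_of_abs_row_eq {n m : ℕ} (l : Fin n → Fin m → Bool)
    (L : List (Fin n)) (hL : L.Nodup) (s : S (hS n m)) {i : Fin n} (hi : i ∈ L)
    (h : |s.2.1.1| = ((i : ℕ) : ℤ) + 1) : (L.map (b l)).prod⁻¹ s = b l i s := by
  induction L with
  | nil => simp at hi
  | cons k L ih =>
    obtain ⟨hk, hL⟩ := List.nodup_cons.mp hL
    rw [List.map_cons, List.prod_cons, mul_inv_rev, Equiv.Perm.mul_apply, b_inv]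
    by_cases hik : i = k
    · subst hik
      refine prod_b_inv_apply_of_abs_row_ne l L _ fun j hj => ?_
      rw [abs_row_b, h]
      have : j ≠ i := fun e => hk (e ▸ hj)
      omega
    · rw [b_apply_of_abs_row_ne l k s (by omega)]
      exact ih hL ((List.mem_cons.mp hi).resolve_left hik)

theorem bit_eq_false_of_neg {m : ℕ} (w : Fin m → Bool) {c : ℤ} (hc : c < 0) :
    bit w c = false := dif_neg (by omega)

/-- The cubies in rows `±i` whose sticker is turned over by `bᵢ`. -/
theorem b_sticker_iff {n m : ℕ} (l : Fin n → Fin m → Bool) (i : Fin n)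
    (c r : I (hS n m)) (h : |r.1| = ((i : ℕ) : ℤ) + 1) :
    ((b l i (c, r, (0, 0))).2.2.1 + (b l i (c, r, (0, 0))).2.2.2 = 1) ↔
      r.1 = ((i : ℕ) : ℤ) + 1 ∧ bit (l i) |c.1| = false := by
  have row_eq_iff : ∀ x : I (hS n m), x = rowIdx i ↔ x.1 = ((i : ℕ) : ℤ) + 1 :=
    fun x => Subtype.ext_iff
  have two : (1 : ZMod 2) + 1 = 0 := by decide
  rw [b_apply]
  have hr : r.1 = ((i : ℕ) : ℤ) + 1 ∨ r.1 = -(((i : ℕ) : ℤ) + 1) := eq_or_eq_neg_of_abs_eq h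
  have hne : ¬ (-(((i : ℕ) : ℤ) + 1) = ((i : ℕ) : ℤ) + 1) := by omega
  rcases lt_or_gt_of_ne c.2.1 with hc | hc
  · rw [abs_of_neg hc]
    have hb := bit_eq_false_of_neg (l i) hc
    rcases hr with hr | hr <;> cases hb' : bit (l i) (-c.1) <;> simp_all [a_apply, Y_apply]
  · rw [abs_of_pos hc]
    have hb := bit_eq_false_of_neg (l i) (neg_lt_zero.mpr hc)
    rcases hr with hr | hr <;> cases hb' : bit (l i) c.1 <;> simp_all [a_apply, Y_apply]

/-- coloring of the top face of `b(C₀)`. -/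
theorem stmt_3 (n m : ℕ) (hn : 0 < n) (hm : 0 < m) (l : Fin n → Fin m → Bool)
    (c r : I (hS n m)) :
    (((bprod l)⁻¹ (c, r, ((0 : ZMod 2), (0 : ZMod 2)))).2.2.1 +
        ((bprod l)⁻¹ (c, r, ((0 : ZMod 2), (0 : ZMod 2)))).2.2.2 = 1) ↔
      ∃ i : Fin n, r.1 = ((i : ℕ) : ℤ) + 1 ∧ bit (l i) |c.1| = false := by
  rw [bprod]
  by_cases h : ∃ i : Fin n, |r.1| = ((i : ℕ) : ℤ) + 1
  · obtain ⟨i, hi⟩ := h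
    rw [prod_b_inv_apply_of_abs_row_eq l _ (List.nodup_finRange n) _ (List.mem_finRange i) hi,
      b_sticker_iff l i c r hi]
    constructor
    · exact fun h => ⟨i, h⟩
    · rintro ⟨k, hk, hb⟩
      have hki : k = i := by
        rw [hk, abs_of_nonneg (by omega)] at hi
        omega
      exact hki ▸ ⟨hk, hb⟩
  · rw [prod_b_inv_apply_of_abs_row_ne l _ _ fun i _ hi => h ⟨i, hi⟩]
    refine iff_of_false (by simp) ?_
    rintro ⟨i, hi, -⟩
    exact h ⟨i, by rw [hi, abs_of_nonneg (by omega)]⟩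

end RSq
end

section
/- Suppose the bitstrings l₁, …, lₙ are pairwise distinct and lₙ is the all-zeros bitstring. Suppose g₁, …, g_{k′} with k′ ≤ 2n − 1 are permutations of S, each equal to X j or Y i for some i, j ∈ I, such that g_{k′} ⋯ g₂ · g₁ · t is the identity permutation of S. Then there is a bijection σ of {1, …, n} such that the Hamming distance between l_{σ(p)} and l_{σ(p+1)} equals 1 for every 1 ≤ p ≤ n − 1. -/
namespace RSq

instance instLawfulBEqSum {α β : Type*} [BEq α] [BEq β] [LawfulBEq α] [LawfulBEq β] :
    LawfulBEq (α ⊕ β) where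
  eq_of_beq {x y} hxy := by
    cases x <;> cases y
    · exact congrArg _ (eq_of_beq (α := α) hxy)
    · cases hxy
    · cases hxy
    · exact congrArg _ (eq_of_beq (α := β) hxy)
  rfl {x} := by
    cases x
    · exact beq_self_eq_true (α := α) _
    · exact beq_self_eq_true (α := β) _

/-- The permutation performed by a single move: `inl j` is a column move, `inr i` a row move. -/
def movePerm {h : ℕ} : I h ⊕ I h → Equiv.Perm (S h) := Sum.elim X Y

/-- The product of a word of moves; the last letter is applied first. -/
def wordPerm {h : ℕ} (w : List (I h ⊕ I h)) : Equiv.Perm (S h) := (w.map movePerm).prod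

section Moves

variable {h : ℕ}

theorem I.neg_ne_self (i : I h) : -i ≠ i := by
  intro hi
  have h1 : -i.1 = i.1 := congrArg Subtype.val hi
  exact i.2.1 (by omega)

theorem I.neg_involutive : Function.Involutive (Neg.neg : I h → I h) := I.neg_neg

theorem I.iterate_neg_eq_or (k : ℕ) (i : I h) : Neg.neg^[k] i = i ∨ Neg.neg^[k] i = -i := by
  rcases Nat.even_or_odd k with hk | hk
  · simp [I.neg_involutive.iterate_even hk]
  · simp [I.neg_involutive.iterate_odd hk]

theorem X_apply_s5 (j c r : I h) (ε : ZMod 2 × ZMod 2) :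
    X j (c, r, ε) = if c = j then (c, -r, (ε.1 + 1, ε.2)) else (c, r, ε) := rfl

theorem Y_apply_s5 (i c r : I h) (ε : ZMod 2 × ZMod 2) :
    Y i (c, r, ε) = if r = i then (-c, r, (ε.1, ε.2 + 1)) else (c, r, ε) := rfl

@[simp] theorem wordPerm_nil : wordPerm ([] : List (I h ⊕ I h)) = 1 := rfl

@[simp] theorem wordPerm_cons (x : I h ⊕ I h) (w : List (I h ⊕ I h)) :
    wordPerm (x :: w) = movePerm x * wordPerm w := by simp [wordPerm]

@[simp] theorem wordPerm_append (v w : List (I h ⊕ I h)) :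
    wordPerm (v ++ w) = wordPerm v * wordPerm w := by simp [wordPerm]

theorem movePerm_mul_self (x : I h ⊕ I h) : movePerm x * movePerm x = 1 := by
  rcases x with j | j
  · exact Equiv.ext (X j).symm_apply_apply
  · exact Equiv.ext (Y j).symm_apply_apply

theorem wordPerm_reverse (w : List (I h ⊕ I h)) : wordPerm w.reverse = (wordPerm w)⁻¹ := by
  induction w with
  | nil => simp
  | cons x w ih => simp [ih, ← eq_inv_of_mul_eq_one_left (movePerm_mul_self x)]

/-- A cubie in a row pair without row moves is only flipped by the moves of its own column. -/
theorem wordPerm_apply_of_row {w : List (I h ⊕ I h)} {i : I h}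
    (h₁ : Sum.inr i ∉ w) (h₂ : Sum.inr (-i) ∉ w) {c r : I h} (hr : r = i ∨ r = -i)
    (ε : ZMod 2 × ZMod 2) :
    wordPerm w (c, r, ε) =
      (c, Neg.neg^[w.count (Sum.inl c)] r, (ε.1 + (w.count (Sum.inl c) : ℕ), ε.2)) := by
  induction w with
  | nil => simp
  | cons x w ih =>
    simp only [List.mem_cons, not_or] at h₁ h₂
    rw [wordPerm_cons, Equiv.Perm.mul_apply, ih h₁.2 h₂.2]
    rcases x with j | j
    · by_cases hj : c = j
      · subst hj
        simp [movePerm, X_apply_s5, Function.iterate_succ_apply', add_assoc]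
      · have hj' : j ≠ c := fun e => hj e.symm
        simp [movePerm, X_apply_s5, hj, hj']
    · have hne : Neg.neg^[w.count (Sum.inl c)] r ≠ j := by
        have h1 : i ≠ j := fun e => h₁.1 (by rw [e])
        have h2 : -i ≠ j := fun e => h₂.1 (by rw [e])
        rcases I.iterate_neg_eq_or (w.count (Sum.inl c)) r with e | e <;>
          rcases hr with rfl | rfl <;> simpa [e]
      simp [movePerm, Y_apply_s5, hne]

/-- A cubie in a column pair without column moves is only flipped by the moves of its own row. -/
theorem wordPerm_apply_of_column {w : List (I h ⊕ I h)} {u : I h}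
    (h₁ : Sum.inl u ∉ w) (h₂ : Sum.inl (-u) ∉ w) {c : I h} (hc : c = u ∨ c = -u) (r : I h)
    (ε : ZMod 2 × ZMod 2) :
    wordPerm w (c, r, ε) =
      (Neg.neg^[w.count (Sum.inr r)] c, r, (ε.1, ε.2 + (w.count (Sum.inr r) : ℕ))) := by
  induction w with
  | nil => simp
  | cons x w ih =>
    simp only [List.mem_cons, not_or] at h₁ h₂
    rw [wordPerm_cons, Equiv.Perm.mul_apply, ih h₁.2 h₂.2]
    rcases x with j | j
    · have hne : Neg.neg^[w.count (Sum.inr r)] c ≠ j := by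
        have h1 : u ≠ j := fun e => h₁.1 (by rw [e])
        have h2 : -u ≠ j := fun e => h₂.1 (by rw [e])
        rcases I.iterate_neg_eq_or (w.count (Sum.inr r)) c with e | e <;>
          rcases hc with rfl | rfl <;> simpa [e]
      simp [movePerm, X_apply_s5, hne]
    · by_cases hj : r = j
      · subst hj
        simp [movePerm, Y_apply_s5, Function.iterate_succ_apply', add_assoc]
      · have hj' : j ≠ r := fun e => hj e.symm
        simp [movePerm, Y_apply_s5, hj, hj']

theorem even_count_row_of_wordPerm_eq_one {w : List (I h ⊕ I h)} (hw : wordPerm w = 1) {u : I h}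
    (h₁ : Sum.inl u ∉ w) (h₂ : Sum.inl (-u) ∉ w) (r : I h) : Even (w.count (Sum.inr r)) := by
  have key := wordPerm_apply_of_column h₁ h₂ (Or.inl rfl) r (0, 0)
  simp only [hw, Equiv.Perm.one_apply, Prod.mk.injEq, zero_add] at key
  exact (ZMod.natCast_eq_zero_iff_even).1 key.2.2.2.symm

/-- If the rows `i` and `-i` are moved exactly twice in a trivial word, both times through row `i`,
then between these two moves each column is moved an even number of times. -/
theorem even_count_column_between {P Q R : List (I h ⊕ I h)} {i : I h}
    (hw : wordPerm (R ++ Sum.inr i :: (Q ++ Sum.inr i :: P)) = 1)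
    (hP : Sum.inr i ∉ P ∧ Sum.inr (-i) ∉ P) (hQ : Sum.inr i ∉ Q ∧ Sum.inr (-i) ∉ Q)
    (hR : Sum.inr i ∉ R ∧ Sum.inr (-i) ∉ R) (c : I h) : Even (Q.count (Sum.inl c)) := by
  by_contra hodd
  rw [Nat.not_even_iff_odd] at hodd
  have hr : Neg.neg^[P.count (Sum.inl c)] (-i) = i ∨ Neg.neg^[P.count (Sum.inl c)] (-i) = -i := by
    rcases I.iterate_neg_eq_or (P.count (Sum.inl c)) (-i) with e | e <;> simp [e]
  have key := congrArg (fun f => (f (c, Neg.neg^[P.count (Sum.inl c)] (-i), (0, 0))).2.2.2) hw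
  have hback : Neg.neg^[P.count (Sum.inl c)] (Neg.neg^[P.count (Sum.inl c)] (-i)) = -i := by
    rw [← Function.iterate_add_apply, I.neg_involutive.iterate_even (Even.add_self _), id]
  simp only [wordPerm_append, wordPerm_cons, Equiv.Perm.mul_apply, movePerm, Sum.elim_inr,
    Equiv.Perm.one_apply] at key
  rw [wordPerm_apply_of_row hP.1 hP.2 hr, hback, Y_apply_s5 i c (-i), if_neg (I.neg_ne_self i),
    wordPerm_apply_of_row hQ.1 hQ.2 (Or.inr rfl), I.neg_involutive.iterate_odd hodd, I.neg_neg,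
    Y_apply_s5, if_pos rfl, wordPerm_apply_of_row hR.1 hR.2 (Or.inl rfl)] at key
  simp at key

end Moves

theorem sum_countP_le_length {ι α : Type*} [Fintype ι] (p : ι → α → Bool)
    (hp : ∀ x k k', p k x → p k' x → k = k') (w : List α) :
    ∑ k, w.countP (p k) ≤ w.length := by
  classical
  induction w with
  | nil => simp
  | cons x w ih =>
    have hx : ∑ k, (if p k x then 1 else 0) ≤ 1 := by
      rw [← Finset.card_filter, Finset.card_le_one]
      intro k hk k' hk'
      exact hp x k k' (by simpa using hk) (by simpa using hk')
    simp only [List.countP_cons, Finset.sum_add_distrib, List.length_cons]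
    omega

theorem length_filterMap_getLeft?_add {α β : Type*} (w : List (α ⊕ β)) :
    (w.filterMap Sum.getLeft?).length + (w.filterMap Sum.getRight?).length = w.length := by
  induction w with
  | nil => rfl
  | cons x w ih => cases x <;> simp [List.filterMap_cons] <;> omega

theorem count_filterMap_getLeft? {α β : Type*} [DecidableEq α] [DecidableEq β]
    (w : List (α ⊕ β)) (x : α) :
    (w.filterMap Sum.getLeft?).count x = w.count (Sum.inl x) := by
  induction w with
  | nil => rfl
  | cons y w ih => cases y <;> simp [List.filterMap_cons, List.count_cons, ih]

theorem count_filterMap_getRight? {α β : Type*} [DecidableEq α] [DecidableEq β]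
    (w : List (α ⊕ β)) (x : β) :
    (w.filterMap Sum.getRight?).count x = w.count (Sum.inr x) := by
  induction w with
  | nil => rfl
  | cons y w ih => cases y <;> simp [List.filterMap_cons, List.count_cons, ih]

section Target

variable {n m : ℕ}

theorem colIdx_injective : Function.Injective (colIdx (n := n) (m := m)) := by
  intro j j' e
  have := congrArg Subtype.val e
  simp only [colIdx] at this
  exact Fin.ext (by omega)

theorem rowIdx_injective : Function.Injective (rowIdx (n := n) (m := m)) := by
  intro j j' e
  have := congrArg Subtype.val e
  simp only [rowIdx] at this
  exact Fin.ext (by omega)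

theorem rowIdx_ne_neg (i i' : Fin n) : rowIdx (m := m) i ≠ -rowIdx i' := by
  intro e
  have : ((i : ℕ) : ℤ) + 1 = -(((i' : ℕ) : ℤ) + 1) := congrArg Subtype.val e
  omega

/-- The word of `aᵢ`. -/
def aWord (l : Fin n → Fin m → Bool) (i : Fin n) : List (I (hS n m) ⊕ I (hS n m)) :=
  ((List.finRange m).filter (l i)).map (fun j => Sum.inl (colIdx j))

/-- The word of `bᵢ`. -/
def bWord (l : Fin n → Fin m → Bool) (i : Fin n) : List (I (hS n m) ⊕ I (hS n m)) :=
  (aWord l i).reverse ++ Sum.inr (rowIdx i) :: aWord l i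

theorem wordPerm_aWord (l : Fin n → Fin m → Bool) (i : Fin n) :
    wordPerm (aWord l i) = a l i := by
  unfold aWord a
  induction List.finRange m with
  | nil => rfl
  | cons j L ih =>
    cases hj : l i j <;> simp [hj, ih, movePerm]

theorem wordPerm_bWord (l : Fin n → Fin m → Bool) (i : Fin n) :
    wordPerm (bWord l i) = b l i := by
  simp [bWord, b, wordPerm_reverse, wordPerm_aWord, movePerm, mul_assoc]

theorem wordPerm_flatMap_bWord (l : Fin n → Fin m → Bool) (L : List (Fin n)) :
    wordPerm (L.flatMap (bWord l)) = (L.map (b l)).prod := by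
  induction L with
  | nil => rfl
  | cons i L ih => simp [ih, wordPerm_bWord]

theorem inr_notMem_aWord (l : Fin n → Fin m → Bool) (i : Fin n) (r : I (hS n m)) :
    Sum.inr r ∉ aWord l i := by
  simp [aWord]

theorem count_inr_aWord (l : Fin n → Fin m → Bool) (i : Fin n) (r : I (hS n m)) :
    (aWord l i).count (Sum.inr r) = 0 :=
  List.count_eq_zero_of_not_mem (inr_notMem_aWord l i r)

theorem inl_notMem_aWord (l : Fin n → Fin m → Bool) (i : Fin n) {u : I (hS n m)}
    (hu : ∀ j, colIdx j ≠ u) : Sum.inl u ∉ aWord l i := by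
  simp [aWord, hu]

theorem count_colIdx_aWord (l : Fin n → Fin m → Bool) (i : Fin n) (j : Fin m) :
    (aWord l i).count (Sum.inl (colIdx j)) = if l i j then 1 else 0 := by
  have hinj : Function.Injective
      (fun j : Fin m => (Sum.inl (colIdx j) : I (hS n m) ⊕ I (hS n m))) :=
    Sum.inl_injective.comp colIdx_injective
  have hnd : (aWord l i).Nodup := ((List.nodup_finRange m).filter _).map hinj
  rw [hnd.count]
  simp [aWord, colIdx_injective.eq_iff]

theorem inr_mem_flatMap_bWord (l : Fin n → Fin m → Bool) (L : List (Fin n)) (r : I (hS n m)) :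
    Sum.inr r ∈ L.flatMap (bWord l) ↔ ∃ i ∈ L, r = rowIdx i := by
  simp [bWord, inr_notMem_aWord]

theorem even_count_inl_flatMap_bWord (l : Fin n → Fin m → Bool) (L : List (Fin n))
    (c : I (hS n m)) : Even ((L.flatMap (bWord l)).count (Sum.inl c)) := by
  induction L with
  | nil => simp
  | cons i L ih =>
    rw [List.flatMap_cons, List.count_append]
    exact Even.add (by simp [bWord]) ih

theorem count_inr_flatMap_bWord (l : Fin n → Fin m → Bool) (L : List (Fin n)) (r : I (hS n m)) :
    (L.flatMap (bWord l)).count (Sum.inr r) = L.countP (fun i => rowIdx i = r) := by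
  induction L with
  | nil => simp
  | cons i L ih =>
    simp [ih, bWord, count_inr_aWord, List.count_cons, List.countP_cons, add_comm]

/-- The word of `t`. -/
def tWord (hn : 0 < n) (l : Fin n → Fin m → Bool) : List (I (hS n m) ⊕ I (hS n m)) :=
  aWord l ⟨0, hn⟩ ++ (List.finRange n).flatMap (bWord l)

theorem wordPerm_tWord (hn : 0 < n) (l : Fin n → Fin m → Bool) :
    wordPerm (tWord hn l) = t hn l := by
  simp [tWord, t, wordPerm_aWord, wordPerm_flatMap_bWord]

theorem inl_notMem_tWord (hn : 0 < n) (l : Fin n → Fin m → Bool) {u : I (hS n m)}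
    (hu : ∀ j, colIdx j ≠ u) : Sum.inl u ∉ tWord hn l := by
  simp [tWord, bWord, inl_notMem_aWord l _ hu]

theorem count_rowIdx_tWord (hn : 0 < n) (l : Fin n → Fin m → Bool) (i : Fin n) :
    (tWord hn l).count (Sum.inr (rowIdx i)) = 1 := by
  have : (List.finRange n).countP (fun k => rowIdx (m := m) k = rowIdx i) = 1 := by
    simp only [rowIdx_injective.eq_iff]
    exact List.count_eq_one_of_mem (List.nodup_finRange n) (List.mem_finRange i)
  simp [tWord, count_inr_aWord, count_inr_flatMap_bWord, this]

theorem count_neg_rowIdx_tWord (hn : 0 < n) (l : Fin n → Fin m → Bool) (i : Fin n) :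
    (tWord hn l).count (Sum.inr (-rowIdx i)) = 0 := by
  simp [tWord, count_inr_aWord, count_inr_flatMap_bWord, rowIdx_ne_neg]

/-- A word shorter than `2n` leaves some pair of outer columns alone. -/
theorem exists_unmoved_column {w : List (I (hS n m) ⊕ I (hS n m))} (hw : w.length < 2 * n) :
    ∃ u : I (hS n m), (∀ j, colIdx j ≠ u) ∧ (∀ j, colIdx j ≠ -u) ∧
      Sum.inl u ∉ w ∧ Sum.inl (-u) ∉ w := by
  let u (k : Fin (2 * n)) : I (hS n m) := ⟨((max m n + k + 1 : ℕ) : ℤ), by omega, by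
    rw [abs_of_nonneg (by omega)]; have := k.2; simp only [hS]; omega⟩
  have hu (k) : (u k).1 = ((max m n + k + 1 : ℕ) : ℤ) := rfl
  have hneg (k) : (-u k).1 = -((max m n + k + 1 : ℕ) : ℤ) := rfl
  have hcol (j : Fin m) : (colIdx (n := n) j).1 = (j : ℕ) + 1 := rfl
  by_contra! hcon
  have hmem (k) : Sum.inl (u k) ∈ w ∨ Sum.inl (-u k) ∈ w := by
    by_contra! hk
    refine hk.2 (hcon (u k) (fun j e => ?_) (fun j e => ?_) hk.1)
    · have := congrArg Subtype.val e
      rw [hu, hcol] at this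
      have := j.2
      omega
    · have := congrArg Subtype.val e
      rw [hneg, hcol] at this
      omega
  have hsum := sum_countP_le_length
    (fun k x => decide (x = Sum.inl (u k) ∨ x = Sum.inl (-u k))) (by
      intro x k k' hk hk'
      have hor : u k = u k' ∨ u k = -u k' ∨ -u k = u k' ∨ -u k = -u k' := by
        simp only [decide_eq_true_eq] at hk hk'
        rcases hk with rfl | rfl <;> rcases hk' with e | e <;> simp [Sum.inl.inj e]
      have hcases := hor.imp (congrArg Subtype.val)
        (Or.imp (congrArg Subtype.val) (Or.imp (congrArg Subtype.val) (congrArg Subtype.val)))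
      simp only [hu, hneg] at hcases
      exact Fin.ext (by omega)) w
  have hge : ∑ _k : Fin (2 * n), 1 ≤
      ∑ k, w.countP (fun x => decide (x = Sum.inl (u k) ∨ x = Sum.inl (-u k))) := by
    refine Finset.sum_le_sum fun k _ => List.countP_pos_iff.2 ?_
    rcases hmem k with hk | hk
    · exact ⟨_, hk, by simp⟩
    · exact ⟨_, hk, by simp⟩
  rw [Fin.sum_const, smul_eq_mul, mul_one] at hge
  omega

/-- The column parities needed when row `i` is moved. -/
def target (hn : 0 < n) (l : Fin n → Fin m → Bool) (i : Fin n) (j : Fin m) : ZMod 2 :=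
  (if l ⟨0, hn⟩ j then 1 else 0) + (if l i j then 1 else 0)

theorem target_eq_iff (hn : 0 < n) (l : Fin n → Fin m → Bool) (i i' : Fin n) (j : Fin m) :
    target hn l i j = target hn l i' j ↔ l i j = l i' j := by
  unfold target
  cases l i j <;> cases l i' j <;> simp

theorem target_injective (hn : 0 < n) {l : Fin n → Fin m → Bool} (hl : Function.Injective l) :
    Function.Injective (target hn l) := fun i i' e =>
  hl (funext fun j => (target_eq_iff hn l i i' j).1 (congrFun e j))

theorem hammingDist_target (hn : 0 < n) (l : Fin n → Fin m → Bool) (i i' : Fin n) :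
    hammingDist (target hn l i) (target hn l i') = hammingDist (l i) (l i') := by
  simp [hammingDist, target_eq_iff]

/-- If the word `w` undoes `t` and moves the rows `±i` only once, through row `i`, then at the time
of this move the column parities are the ones prescribed by `target`. -/
theorem natCast_count_eq_target (hn : 0 < n) (l : Fin n → Fin m → Bool)
    {R Q : List (I (hS n m) ⊕ I (hS n m))} {i : Fin n}
    (hw : wordPerm ((R ++ Sum.inr (rowIdx i) :: Q) ++ tWord hn l) = 1)
    (hR : Sum.inr (rowIdx i) ∉ R ∧ Sum.inr (-rowIdx i) ∉ R)
    (hQ : Sum.inr (rowIdx i) ∉ Q ∧ Sum.inr (-rowIdx i) ∉ Q) (j : Fin m) :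
    ((Q.count (Sum.inl (colIdx j)) : ℕ) : ZMod 2) = target hn l i j := by
  obtain ⟨L₁, L₂, hL⟩ := List.append_of_mem (List.mem_finRange i)
  have hnd : (L₁ ++ i :: L₂).Nodup := hL ▸ List.nodup_finRange n
  have hi₁ : i ∉ L₁ := fun hi => (List.disjoint_of_nodup_append hnd) hi List.mem_cons_self
  have hi₂ : i ∉ L₂ := fun hi => by simp [List.nodup_append, hi] at hnd
  have havoid (L : List (Fin n)) (hi : i ∉ L) : Sum.inr (rowIdx i) ∉ L.flatMap (bWord l) ∧
      Sum.inr (-rowIdx i) ∉ L.flatMap (bWord l) := by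
    simp only [inr_mem_flatMap_bWord, rowIdx_injective.eq_iff]
    refine ⟨fun ⟨k, hk, e⟩ => hi (e ▸ hk), fun ⟨k, _, e⟩ => rowIdx_ne_neg k i e.symm⟩
  have hsplit : (R ++ Sum.inr (rowIdx i) :: Q) ++ tWord hn l = R ++ Sum.inr (rowIdx i) ::
      ((Q ++ (aWord l ⟨0, hn⟩ ++ (L₁.flatMap (bWord l) ++ (aWord l i).reverse))) ++
        Sum.inr (rowIdx i) :: (aWord l i ++ L₂.flatMap (bWord l))) := by
    simp [tWord, hL, bWord]
  rw [hsplit] at hw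
  have heven := even_count_column_between hw
    (by simpa only [List.mem_append, inr_notMem_aWord, false_or] using havoid L₂ hi₂)
    (by simpa only [List.mem_append, List.mem_reverse, inr_notMem_aWord, false_or, or_false,
          not_or, hQ, not_false_eq_true, true_and] using havoid L₁ hi₁) hR (colIdx j)
  obtain ⟨k, hk⟩ := even_count_inl_flatMap_bWord l L₁ (colIdx j)
  rw [← ZMod.natCast_eq_zero_iff_even] at heven
  simp only [List.count_append, List.count_reverse, count_colIdx_aWord, hk] at heven
  unfold target
  push_cast at heven
  rw [CharTwo.add_self_eq_zero, zero_add] at heven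
  exact CharTwo.add_eq_zero.1 heven

end Target

/-- a ≤ 2n−1 move sequence inverting `t` yields a Hamiltonian path
through the bitstrings. -/
theorem stmt_5 (n m : ℕ) (hn : 0 < n) (hm : 0 < m) (l : Fin n → Fin m → Bool)
    (hdist : Function.Injective l)
    (hlast : l ⟨n - 1, by omega⟩ = fun _ => false)
    (k' : ℕ) (hk : k' ≤ 2 * n - 1) (g : Fin k' → Equiv.Perm (S (hS n m)))
    (hmoves : ∀ q, (∃ j, g q = X j) ∨ (∃ i, g q = Y i))
    (hsolve : (List.ofFn g).reverse.prod * t hn l = 1) :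
    ∃ σ : Equiv.Perm (Fin n), ∀ (p : ℕ) (hp : p + 1 < n),
      hammingDist (l (σ ⟨p, by omega⟩)) (l (σ ⟨p + 1, hp⟩)) = 1 := by
  have hmove (q) : ∃ x, g q = movePerm x := by
    rcases hmoves q with ⟨j, hj⟩ | ⟨i, hi⟩
    · exact ⟨Sum.inl j, hj⟩
    · exact ⟨Sum.inr i, hi⟩
  choose x hx using hmove
  obtain ⟨w, hlen, hw⟩ : ∃ w : List (I (hS n m) ⊕ I (hS n m)), w.length = k' ∧
      wordPerm (w ++ tWord hn l) = 1 := by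
    refine ⟨(List.ofFn x).reverse, by simp, ?_⟩
    rw [wordPerm_append, wordPerm_tWord, ← hsolve, wordPerm, List.map_reverse, List.map_ofFn]
    rw [funext hx]
    rfl
  obtain ⟨u, hu₁, hu₂, huw₁, huw₂⟩ := exists_unmoved_column (m := m) (w := w) (n := n) (by omega)
  have heven (r) := even_count_row_of_wordPerm_eq_one hw (u := u)
    (by simp [huw₁, inl_notMem_tWord hn l hu₁]) (by simp [huw₂, inl_notMem_tWord hn l hu₂]) r
  have hodd (i : Fin n) : Odd (w.count (Sum.inr (rowIdx i))) := by
    have := heven (rowIdx i)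
    rw [List.count_append, count_rowIdx_tWord] at this
    grind
  have heven' (i : Fin n) : Even (w.count (Sum.inr (-rowIdx i))) := by
    have := heven (-rowIdx i)
    rwa [List.count_append, count_neg_rowIdx_tWord] at this
  set xs := w.filterMap Sum.getLeft? with hxs
  set ys := w.filterMap Sum.getRight? with hys
  have hxy : xs.length + ys.length = w.length := length_filterMap_getLeft?_add w
  let v (p : ℕ) (j : Fin m) : ZMod 2 := ((xs.drop p).count (colIdx j) : ℕ)
  let good : Finset (Fin n) := {i | w.count (Sum.inr (rowIdx i)) = 1 ∧
    w.count (Sum.inr (-rowIdx i)) = 0}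
  have hvisit (i) (hi : i ∈ good) : ∃ p ≤ xs.length, v p = target hn l i := by
    simp only [good, Finset.mem_filter, Finset.mem_univ, true_and] at hi
    obtain ⟨R, Q, hRQ⟩ := List.append_of_mem (List.count_pos_iff.1 (hi.1 ▸ Nat.one_pos))
    have h₁ := hi.1
    have h₂ := hi.2
    simp only [hRQ, List.count_append, List.count_cons_self] at h₁
    rw [List.count_eq_zero, hRQ] at h₂
    simp only [List.mem_append, List.mem_cons, not_or] at h₂
    rw [hRQ] at hw
    have hcount := natCast_count_eq_target hn l hw
      ⟨List.count_eq_zero.1 (by omega), h₂.1⟩ ⟨List.count_eq_zero.1 (by omega), h₂.2.2⟩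
    refine ⟨(R.filterMap Sum.getLeft?).length, ?_, funext fun j => ?_⟩
    · simp [hxs, hRQ]
    · rw [← hcount j]
      simp [v, hxs, hRQ, count_filterMap_getLeft?]
  choose! f hf hfv using hvisit
  have hfinj : Set.InjOn f good := fun i hi i' hi' e =>
    target_injective hn hdist (by rw [← hfv i hi, ← hfv i' hi', e])
  have hcols : good.card ≤ xs.length + 1 := by
    simpa using Finset.card_le_card_of_injOn (t := Finset.range (xs.length + 1)) f
      (fun i hi => by simpa [Nat.lt_succ_iff] using hf i hi) hfinj
  have hrows : ∑ i : Fin n, (if i ∈ good then 1 else 3) ≤ ys.length := by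
    refine le_trans (Finset.sum_le_sum fun i _ => ?_)
      (sum_countP_le_length (fun (i : Fin n) y => decide (y = rowIdx i ∨ y = -rowIdx i)) ?_ ys)
    · have hsum : ys.countP (fun y => decide (y = rowIdx i ∨ y = -rowIdx i)) =
          w.count (Sum.inr (rowIdx i)) + w.count (Sum.inr (-rowIdx i)) := by
        rw [← count_filterMap_getRight?, ← count_filterMap_getRight?, ← hys]
        clear_value ys
        clear hys hxy
        induction ys with
        | nil => rfl
        | cons y ys ih =>
          have := I.neg_ne_self (rowIdx (m := m) i)
          simp only [List.countP_cons, List.count_cons, ih]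
          grind
      rw [hsum]
      obtain ⟨p, hp⟩ := hodd i
      obtain ⟨q, hq⟩ := heven' i
      split_ifs with hi
      · omega
      · simp only [good, Finset.mem_filter, Finset.mem_univ, true_and] at hi
        omega
    · intro y k k' hk hk'
      simp only [decide_eq_true_eq] at hk hk'
      rcases hk with rfl | rfl <;> rcases hk' with e | e
      · exact rowIdx_injective e
      · exact absurd e (rowIdx_ne_neg _ _)
      · exact absurd e.symm (rowIdx_ne_neg _ _)
      · exact rowIdx_injective (I.neg_involutive.injective e)
  have hcard : good.card ≤ n := by simpa using good.card_le_univ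
  have hrows' : good.card + 3 * (n - good.card) ≤ ys.length := by
    refine le_of_eq_of_le ?_ hrows
    rw [Finset.sum_ite, Finset.filter_mem_eq_inter, Finset.univ_inter, Finset.filter_not,
      Finset.filter_mem_eq_inter, Finset.univ_inter, ← Finset.compl_eq_univ_sdiff]
    simp [Finset.card_compl, mul_comm]
  have hall : good = Finset.univ := Finset.card_eq_iff_eq_univ _ |>.1 (by simp; omega)
  simp only [hall, Finset.card_univ, Fintype.card_fin, Finset.mem_univ, forall_const,
    Finset.coe_univ, Set.injOn_univ] at *
  have hfn (i) : f i < n := by have := hf i; omega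
  have hbij : Function.Bijective (fun i => (⟨f i, hfn i⟩ : Fin n)) :=
    Finite.injective_iff_bijective.1 fun i i' e => hfinj (congrArg Fin.val e)
  let σ := (Equiv.ofBijective _ hbij).symm
  have hσ (p : Fin n) : target hn l (σ p) = v p := by
    rw [← hfv]
    exact congrArg (fun k : Fin n => v k) ((Equiv.ofBijective _ hbij).apply_symm_apply p)
  refine ⟨σ, fun p hp => le_antisymm ?_ ?_⟩
  · rw [← hammingDist_target hn l, hσ, hσ, hammingDist, Finset.card_le_one]
    have hdrop := List.drop_eq_getElem_cons (l := xs) (i := p) (by omega)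
    have hchange (j) (hj : v p j ≠ v (p + 1) j) : colIdx j = xs[p] := by
      by_contra hne
      exact hj (by simp only [v]; rw [hdrop, List.count_cons_of_ne (Ne.symm hne)])
    intro j hj j' hj'
    simp only [Finset.mem_filter, Finset.mem_univ, true_and] at hj hj'
    exact colIdx_injective ((hchange j hj).trans (hchange j' hj').symm)
  · rw [Nat.one_le_iff_ne_zero, hammingDist_ne_zero, hdist.ne_iff, σ.injective.ne_iff]
    simp


end RSq
end
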